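/- arXiv:1710.09966 — 3 statements merged into one kernel-verified Lean document; each statement's English description precedes it below -/
import Mathlib

section
/- If w ∈ V satisfies E w = 0 and H w = n·w for a natural number n, then E(F^{2n+1} w) = 0. -/
/-- In any ring, if `H = E * F + F * E` satisfies `H * F - F * H = -F`, then moving `E` past an
odd power of `F` gives `E * F ^ (2 * k + 1) = F ^ (2 * k) * (E * F - k)`. -/
theorem mul_odd_pow_of_anticommutator_relation {A : Type*} [Ring A] {E F : A}
    (h : (E * F + F * E) * F - F * (E * F + F * E) = -F) (k : ℕ) :
    E * F ^ (2 * k + 1) = F ^ (2 * k) * (E * F - k) := by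
  have hsq : E * F ^ 2 = F ^ 2 * E - F := by
    have : E * F ^ 2 - F ^ 2 * E = -F := by rw [← h]; noncomm_ring
    rw [sub_eq_iff_eq_add.mp this]; abel
  induction k with
  | zero => simp
  | succ k ih =>
    calc E * F ^ (2 * (k + 1) + 1) = E * F ^ 2 * F ^ (2 * k + 1) := by
          rw [mul_assoc, ← pow_add]; congr 2; ring
      _ = F ^ 2 * (E * F ^ (2 * k + 1)) - F ^ (2 * (k + 1)) := by
          rw [hsq, sub_mul, mul_assoc, ← pow_succ']; rfl
      _ = F ^ (2 * (k + 1)) * (E * F - (k + 1 : ℕ)) := by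
          rw [ih, ← mul_assoc, ← pow_add, show 2 + 2 * k = 2 * (k + 1) by ring]
          push_cast
          noncomm_ring

/-- osp(1|2) vanishing: with `H := E*F + F*E` satisfying `H*F - F*H = -F`,
if `E w = 0` and `H w = n • w` for a natural number `n`, then `E (F^(2n+1) w) = 0`. -/
theorem stmt2 {R : Type*} [CommRing R] {V : Type*} [AddCommGroup V] [Module R V]
    (E F : Module.End R V)
    (h : (E * F + F * E) * F - F * (E * F + F * E) = -F)
    (w : V) (n : ℕ) (hw : E w = 0) (hHw : (E * F + F * E) w = n • w) :
    E ((F ^ (2 * n + 1)) w) = 0 := by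
  have hEF : (E * F) w = n • w := by simpa [hw] using hHw
  rw [← Module.End.mul_apply, mul_odd_pow_of_anticommutator_relation h, Module.End.mul_apply,
    LinearMap.sub_apply, hEF, Module.End.natCast_apply, sub_self, map_zero]
end

section
/- For every integer N ≥ 1 and every index i with 1 ≤ i ≤ m − 1, there is no family of natural numbers (c_α)_{α∈Φ⁺} such that Σ_{α∈Φ⁺} c_α·α = 2N·δ_m + δ_{i+1} − δ_i. -/
/-- For osp(2n|2m) with the standard simple system, `2N·δ_m + δ_{i+1} − δ_i`
(with `N ≥ 1`, `1 ≤ i ≤ m−1`) is not a nonnegative integer combination of positive roots. -/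
theorem stmt14 (m n : ℕ) (hm : 2 ≤ m) (hn : 2 ≤ n)
    (δ : Fin m → (Fin m ⊕ Fin n → ℚ)) (ε : Fin n → (Fin m ⊕ Fin n → ℚ))
    (hδ : ∀ i, δ i = Pi.single (Sum.inl i) 1)
    (hε : ∀ j, ε j = Pi.single (Sum.inr j) 1)
    (N : ℕ) (hN : 1 ≤ N) (i : ℕ) (hi1 : 1 ≤ i) (hi2 : i ≤ m - 1) :
    ¬ ∃ (c₁ c₂ : Fin m → Fin m → ℕ) (c₃ : Fin m → ℕ)
        (c₄ c₅ : Fin n → Fin n → ℕ)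
        (c₆ c₇ : Fin m → Fin n → ℕ),
      (∑ a : Fin m, ∑ b : Fin m,
          if a < b then c₁ a b • (δ a - δ b) + c₂ a b • (δ a + δ b) else 0) +
        (∑ p : Fin m, c₃ p • ((2 : ℚ) • δ p)) +
        (∑ k : Fin n, ∑ l : Fin n,
          if k < l then c₄ k l • (ε k - ε l) + c₅ k l • (ε k + ε l) else 0) +
        (∑ p : Fin m, ∑ q : Fin n, (c₆ p q • (δ p - ε q) + c₇ p q • (δ p + ε q))) =
      (2 * N) • δ ⟨m - 1, by omega⟩ + δ ⟨i, by omega⟩ - δ ⟨i - 1, by omega⟩ := by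
  rintro ⟨c₁, c₂, c₃, c₄, c₅, c₆, c₇, h⟩
  -- The sum of the first `i` coordinates is nonnegative on every positive root.
  let L : (Fin m ⊕ Fin n → ℚ) →ₗ[ℚ] ℚ :=
    ∑ p : Fin m, if (p : ℕ) < i then LinearMap.proj (Sum.inl p) else 0
  have L_apply (v : Fin m ⊕ Fin n → ℚ) :
      L v = ∑ p : Fin m, if (p : ℕ) < i then v (.inl p) else 0 := by
    simp only [L, LinearMap.sum_apply]
    refine Finset.sum_congr rfl fun p _ => ?_
    split_ifs <;> simp
  have L_δ (a : Fin m) : L (δ a) = if (a : ℕ) < i then 1 else 0 := by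
    rw [L_apply, Finset.sum_eq_single a] <;> simp +contextual [hδ]
  have L_ε (k : Fin n) : L (ε k) = 0 := by
    rw [L_apply]
    simp [hε]
  have L_δ_nonneg (a : Fin m) : 0 ≤ L (δ a) := by
    rw [L_δ]
    split_ifs <;> norm_num
  have L_δ_anti {a b : Fin m} (hab : a < b) : L (δ b) ≤ L (δ a) := by
    rw [L_δ, L_δ]
    split_ifs <;> first | omega | norm_num
  have h_neg := congrArg L h
  simp only [map_add, map_sum, map_sub, map_nsmul, map_smul] at h_neg
  rw [L_δ ⟨m - 1, _⟩, L_δ ⟨i, _⟩, L_δ ⟨i - 1, _⟩, if_neg (by simp only; omega),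
    if_neg (by simp only; omega), if_pos (by simp only; omega)] at h_neg
  have h₁ : 0 ≤ ∑ a : Fin m, ∑ b : Fin m,
      L (if a < b then c₁ a b • (δ a - δ b) + c₂ a b • (δ a + δ b) else 0) := by
    refine Finset.sum_nonneg fun a _ => Finset.sum_nonneg fun b _ => ?_
    split_ifs with hab
    · simp only [map_add, map_sub, map_nsmul]
      exact add_nonneg (nsmul_nonneg (sub_nonneg.2 (L_δ_anti hab)) _)
        (nsmul_nonneg (add_nonneg (L_δ_nonneg a) (L_δ_nonneg b)) _)
    · simp
  have h₂ : 0 ≤ ∑ p : Fin m, c₃ p • ((2 : ℚ) • L (δ p)) :=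
    Finset.sum_nonneg fun p _ => nsmul_nonneg (smul_nonneg zero_le_two (L_δ_nonneg p)) _
  have h₃ : 0 ≤ ∑ k : Fin n, ∑ l : Fin n,
      L (if k < l then c₄ k l • (ε k - ε l) + c₅ k l • (ε k + ε l) else 0) := by
    refine Finset.sum_nonneg fun k _ => Finset.sum_nonneg fun l _ => ?_
    split_ifs <;> simp only [map_add, map_sub, map_nsmul, map_zero, L_ε] <;> simp
  have h₄ : 0 ≤ ∑ p : Fin m, ∑ q : Fin n,
      (c₆ p q • (L (δ p) - L (ε q)) + c₇ p q • (L (δ p) + L (ε q))) := by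
    refine Finset.sum_nonneg fun p _ => Finset.sum_nonneg fun q _ => ?_
    simp only [L_ε, sub_zero, add_zero]
    exact add_nonneg (nsmul_nonneg (L_δ_nonneg p) _) (nsmul_nonneg (L_δ_nonneg p) _)
  simp only [smul_zero, zero_add, zero_sub] at h_neg
  linarith
end

section
/- For every integer N ≥ 1 and every index j with 1 ≤ j ≤ n − 2, there is no family of natural numbers (c_α)_{α∈Φ⁺} such that Σ_{α∈Φ⁺} c_α·α = N·(ε_{n−1} + ε_n) + ε_{j+1} − ε_j. -/
/-- The sum of the first `j` coordinates of the second block, as a linear functional. -/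
def partialSum (m n j : ℕ) : (Fin m ⊕ Fin n → ℚ) →ₗ[ℚ] ℚ :=
  ∑ i : Fin n, if (i : ℕ) < j then LinearMap.proj (Sum.inr i) else 0

theorem partialSum_single_inl (m n j : ℕ) (a : Fin m) :
    partialSum m n j (Pi.single (Sum.inl a) 1) = 0 := by
  rw [partialSum, LinearMap.sum_apply]
  refine Finset.sum_eq_zero fun i _ => ?_
  split_ifs <;> simp

theorem partialSum_single_inr (m n j : ℕ) (k : Fin n) :
    partialSum m n j (Pi.single (Sum.inr k) 1) = if (k : ℕ) < j then 1 else 0 := by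
  rw [partialSum, LinearMap.sum_apply, Finset.sum_eq_single k]
  · split_ifs <;> simp
  · intro i _ hik
    split_ifs <;> simp [hik]
  · simp


/-- For osp(2n|2m) with the opposite simple system, `N·(ε_{n−1} + ε_n) + ε_{j+1} − ε_j`
(with `N ≥ 1`, `1 ≤ j ≤ n−2`) is not a nonnegative integer combination of positive roots. -/
theorem stmt15 (m n : ℕ) (hm : 1 ≤ m) (hn : 3 ≤ n)
    (δ : Fin m → (Fin m ⊕ Fin n → ℚ)) (ε : Fin n → (Fin m ⊕ Fin n → ℚ))
    (hδ : ∀ i, δ i = Pi.single (Sum.inl i) 1)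
    (hε : ∀ j, ε j = Pi.single (Sum.inr j) 1)
    (N : ℕ) (hN : 1 ≤ N) (j : ℕ) (hj1 : 1 ≤ j) (hj2 : j ≤ n - 2) :
    ¬ ∃ (c₁ c₂ : Fin m → Fin m → ℕ) (c₃ : Fin m → ℕ)
        (c₄ c₅ : Fin n → Fin n → ℕ)
        (c₆ c₇ : Fin n → Fin m → ℕ),
      (∑ a : Fin m, ∑ b : Fin m,
          if a < b then c₁ a b • (δ a - δ b) + c₂ a b • (δ a + δ b) else 0) +
        (∑ p : Fin m, c₃ p • ((2 : ℚ) • δ p)) +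
        (∑ k : Fin n, ∑ l : Fin n,
          if k < l then c₄ k l • (ε k - ε l) + c₅ k l • (ε k + ε l) else 0) +
        (∑ q : Fin n, ∑ p : Fin m, (c₆ q p • (ε q - δ p) + c₇ q p • (ε q + δ p))) =
      N • (ε ⟨n - 2, by omega⟩ + ε ⟨n - 1, by omega⟩) + ε ⟨j, by omega⟩ - ε ⟨j - 1, by omega⟩ := by
  rintro ⟨c₁, c₂, c₃, c₄, c₅, c₆, c₇, h⟩
  have hφδ (a : Fin m) : partialSum m n j (δ a) = 0 := by
    rw [hδ, partialSum_single_inl]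
  have hφε (k : Fin n) : partialSum m n j (ε k) = if (k : ℕ) < j then 1 else 0 := by
    rw [hε, partialSum_single_inr]
  have hφ := congrArg (partialSum m n j) h
  have h₁ : ¬ n - 2 < j := by omega
  have h₂ : ¬ n - 1 < j := by omega
  have h₃ : j - 1 < j := by omega
  simp only [map_add, map_sub, map_sum, map_nsmul, map_smul, apply_ite (partialSum m n j),
    map_zero, hφδ, hφε, h₁, h₂, h₃, lt_irrefl, if_true, if_false, smul_zero, add_zero, sub_zero,
    ite_self, Finset.sum_const_zero, zero_add, zero_sub] at hφ
  have hε_roots : (0 : ℚ) ≤ ∑ k : Fin n, ∑ l : Fin n, if k < l then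
      c₄ k l • ((if (k : ℕ) < j then (1 : ℚ) else 0) - if (l : ℕ) < j then 1 else 0) +
        c₅ k l • ((if (k : ℕ) < j then (1 : ℚ) else 0) + if (l : ℕ) < j then 1 else 0)
      else 0 := by
    refine Finset.sum_nonneg fun k _ => Finset.sum_nonneg fun l _ => ?_
    split_ifs with hkl hk hl hl
    any_goals first | positivity | (simp; done)
    exact absurd (lt_trans (Fin.lt_def.mp hkl) hl) hk
  have hodd_roots : (0 : ℚ) ≤ ∑ q : Fin n, ∑ p : Fin m,
      (c₆ q p • (if (q : ℕ) < j then (1 : ℚ) else 0) +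
        c₇ q p • (if (q : ℕ) < j then (1 : ℚ) else 0)) := by
    positivity
  linarith
end
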